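/- Let Q be an integrable real-valued random variable with cumulative distribution function F(θ) = ℙ(Q ≤ θ), and fix τ ∈ (0, 1). Define Φ(θ) = θ + (1/(1-τ)) · E[(Q - θ)⁺], where x⁺ = max(x, 0). Then at every θ with ℙ(Q = θ) = 0, the function Φ is differentiable with Φ'(θ) = (F(θ) - τ)/(1 - τ); equivalently, F(θ) = τ + (1-τ) Φ'(θ). -/

import Mathlib

open MeasureTheory

open Filter Topology

lemma hasDerivAt_max_sub_zero {x θ : ℝ} (h : x ≠ θ) :
    HasDerivAt (fun t => max (x - t) 0) ((Set.Ioi θ).indicator (fun _ => (-1 : ℝ)) x) θ := by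
  rcases lt_or_gt_of_ne h with h | h
  · rw [Set.indicator_of_notMem (by simpa using h.le)]
    refine (hasDerivAt_const θ (0 : ℝ)).congr_of_eventuallyEq ?_
    filter_upwards [lt_mem_nhds h] with t ht
    exact max_eq_right (by linarith)
  · rw [Set.indicator_of_mem (by simpa using h)]
    refine ((hasDerivAt_id θ).const_sub x).congr_of_eventuallyEq ?_
    filter_upwards [gt_mem_nhds h] with t ht
    exact max_eq_left (by linarith)

lemma lipschitzWith_max_sub_zero (x : ℝ) : LipschitzWith 1 (fun t : ℝ => max (x - t) 0) :=
  LipschitzWith.max_const (LipschitzWith.of_dist_le_mul fun a b => by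
    rw [dist_sub_left, NNReal.coe_one, one_mul]) 0

lemma hasDerivAt_integral_max_sub_zero {Ω : Type*} [MeasurableSpace Ω] {P : Measure Ω}
    [IsFiniteMeasure P] {Q : Ω → ℝ} (hQm : Measurable Q) (hQ : Integrable Q P)
    {θ : ℝ} (hθ : P {ω | Q ω = θ} = 0) :
    HasDerivAt (fun t => ∫ ω, max (Q ω - t) 0 ∂P) (-P.real {ω | θ < Q ω}) θ := by
  have hmeas : MeasurableSet {ω | θ < Q ω} := measurableSet_lt measurable_const hQm
  have hne : ∀ᵐ ω ∂P, Q ω ≠ θ := by simpa [ae_iff] using hθ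
  have key := (hasDerivAt_integral_of_dominated_loc_of_lip (μ := P)
    (F := fun t ω => max (Q ω - t) 0) (x₀ := θ) (s := Set.univ) (bound := fun _ => 1)
    (F' := {ω | θ < Q ω}.indicator fun _ => (-1 : ℝ)) univ_mem
    (Eventually.of_forall fun t =>
      ((hQm.sub_const t).max measurable_const).aestronglyMeasurable)
    (hQ.sub (integrable_const θ)).pos_part
    (measurable_const.indicator hmeas).aestronglyMeasurable
    (Eventually.of_forall fun ω => by
      simpa using lipschitzWith_max_sub_zero (Q ω))
    (integrable_const 1)
    (hne.mono fun ω hω => hasDerivAt_max_sub_zero hω)).2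
  simpa [integral_indicator_const _ hmeas] using key

/-- Post-processing identity for the CDF: at continuity points of the distribution,
`Φ(θ) = θ + (1/(1-τ)) E[(Q-θ)⁺]` is differentiable with `Φ'(θ) = (F(θ) - τ)/(1 - τ)`,
equivalently `F(θ) = τ + (1-τ) Φ'(θ)`. -/
theorem stmt6 {Ω : Type*} [MeasurableSpace Ω] (P : Measure Ω) [IsProbabilityMeasure P]
    (Q : Ω → ℝ) (hQm : Measurable Q) (hQ : Integrable Q P)
    (τ : ℝ) (hτ : τ ∈ Set.Ioo (0 : ℝ) 1)
    (θ : ℝ) (hθ : P {ω | Q ω = θ} = 0) :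
    HasDerivAt (fun t => t + (1 / (1 - τ)) * ∫ ω, max (Q ω - t) 0 ∂P)
        (((P {ω | Q ω ≤ θ}).toReal - τ) / (1 - τ)) θ ∧
      (P {ω | Q ω ≤ θ}).toReal =
        τ + (1 - τ) * deriv (fun t => t + (1 / (1 - τ)) * ∫ ω, max (Q ω - t) 0 ∂P) θ := by
  have hτ' : 1 - τ ≠ 0 := sub_ne_zero.2 hτ.2.ne'
  have hcompl : P.real {ω | θ < Q ω} = 1 - P.real {ω | Q ω ≤ θ} := by
    rw [← probReal_compl_eq_one_sub (measurableSet_le hQm measurable_const)]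
    congr 1
    ext ω
    simp
  have hderiv : HasDerivAt (fun t => t + (1 / (1 - τ)) * ∫ ω, max (Q ω - t) 0 ∂P)
      (((P {ω | Q ω ≤ θ}).toReal - τ) / (1 - τ)) θ := by
    refine ((hasDerivAt_id' θ).add
      ((hasDerivAt_integral_max_sub_zero hQm hQ hθ).const_mul (1 / (1 - τ)))).congr_deriv ?_
    rw [hcompl, measureReal_def]
    field_simp
    ring
  refine ⟨hderiv, ?_⟩
  rw [hderiv.deriv]
  field_simp
  ring
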